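/- arXiv:math/0205153 — 2 statements merged into one kernel-verified Lean document; each statement's English description precedes it below -/
import Mathlib

section
/- Let d = 2 and suppose E ⊆ (0,∞) satisfies sup_{k>0} sup_{0<δ<1/10} N(E^k, 2^k δ)·δ·log(1/δ) = ∞. Then M_E is not of restricted weak type (2,2): there is no constant C such that meas({x ∈ ℝ² : M_E χ_A(x) > α}) ≤ C α^{−2} meas(A) for all measurable sets A ⊆ ℝ² of finite measure and all α > 0. -/
open MeasureTheory Metric Set Filter
open scoped ENNReal NNReal Topology

noncomputable section

abbrev Ed (d : ℕ) := EuclideanSpace ℝ (Fin d)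

/-- The rotation-invariant probability measure on the unit sphere. -/
def sphereProb (d : ℕ) : Measure (sphere (0 : Ed d) 1) :=
  ((volume : Measure (Ed d)).toSphere Set.univ)⁻¹ • (volume : Measure (Ed d)).toSphere

/-- Spherical mean `A_t f`. -/
def sphMean (d : ℕ) (t : ℝ) (f : Ed d → ℂ) (x : Ed d) : ℂ :=
  ∫ y : sphere (0 : Ed d) 1, f (x - t • (y : Ed d)) ∂(sphereProb d)

/-- Spherical maximal function, with values in `ℝ≥0∞`. -/
def maxFn (d : ℕ) (E : Set ℝ) (f : Ed d → ℂ) (x : Ed d) : ℝ≥0∞ :=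
  ⨆ t ∈ E, (‖sphMean d t f x‖₊ : ℝ≥0∞)

/-- `N(S,δ)`: minimal number of intervals of length `δ` needed to cover `S`
(with the value `1` for the empty set). -/
def covN (S : Set ℝ) (δ : ℝ) : ℕ :=
  max 1 (sInf {n : ℕ | ∃ c : Fin n → ℝ, S ⊆ ⋃ i, Set.Icc (c i) (c i + δ)})

def Ek (E : Set ℝ) (k : ℤ) : Set ℝ := E ∩ Set.Ico ((2:ℝ)^k) ((2:ℝ)^(k+1))

/-- weak type (p,p) for the spherical maximal operator. -/
def WeakTypePP (d : ℕ) (E : Set ℝ) (p : ℝ) : Prop :=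
  ∃ C : ℝ, ∀ f : Ed d → ℂ, Continuous f → HasCompactSupport f → ∀ a : ℝ, 0 < a →
    volume {x | ENNReal.ofReal a < maxFn d E f x} ≤
      ENNReal.ofReal (C * a ^ (-p) * ∫ x, ‖f x‖ ^ p)

open scoped Pointwise

theorem volume_polar_image_ge {D : Set (ℝ × ℝ)} (hD : MeasurableSet D)
    (hDt : D ⊆ polarCoord.target) {r₀ : ℝ} (hr : ∀ z ∈ D, r₀ ≤ z.1) {X : Set (Ed 2)}
    (hX : ∀ z ∈ D, (!₂[z.1 * Real.cos z.2, z.1 * Real.sin z.2] : Ed 2) ∈ X) :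
    ENNReal.ofReal r₀ * volume D ≤ volume X := by
  let e : (ℝ × ℝ) ≃ᵐ Ed 2 :=
    (MeasurableEquiv.finTwoArrow (α := ℝ)).symm.trans (MeasurableEquiv.toLp 2 (Fin 2 → ℝ))
  have he : MeasurePreserving e volume volume :=
    (volume_preserving_finTwoArrow ℝ).symm.trans (PiLp.volume_preserving_toLp (Fin 2))
  rw [← he.measure_preimage_equiv X]
  calc ENNReal.ofReal r₀ * volume D = ∫⁻ _ in D, ENNReal.ofReal r₀ := by
        rw [setLIntegral_const]
    _ ≤ ∫⁻ p in D, ENNReal.ofReal p.1 • (e ⁻¹' X).indicator (fun _ => 1) (polarCoord.symm p) := by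
        refine setLIntegral_mono' hD fun p hp => ?_
        have hmem : polarCoord.symm p ∈ e ⁻¹' X := by
          exact hX p hp
        rw [indicator_of_mem hmem, smul_eq_mul, mul_one]
        exact ENNReal.ofReal_le_ofReal (hr p hp)
    _ ≤ ∫⁻ p in polarCoord.target,
          ENNReal.ofReal p.1 • (e ⁻¹' X).indicator (fun _ => 1) (polarCoord.symm p) :=
        lintegral_mono_set hDt
    _ = ∫⁻ p, (e ⁻¹' X).indicator (fun _ => 1) p := lintegral_comp_polarCoord_symm _
    _ ≤ volume (e ⁻¹' X) := by simpa using lintegral_indicator_const_le (e ⁻¹' X) 1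

theorem sphereProb_arc_ge {S : Set (sphere (0 : Ed 2) 1)} (hS : MeasurableSet S) {α β : ℝ}
    (hα : -Real.pi ≤ α) (hβ : β ≤ Real.pi)
    (h : ∀ ψ ∈ Ioo α β, ∃ y ∈ S, (y : Ed 2) = !₂[Real.cos ψ, Real.sin ψ]) :
    ENNReal.ofReal ((β - α) / 16) ≤ sphereProb 2 S := by
  have h1 : ENNReal.ofReal ((β - α) / 4) ≤
      volume (Ioo (0 : ℝ) 1 • ((fun y : sphere (0 : Ed 2) 1 => (y : Ed 2)) '' S)) := by
    have := volume_polar_image_ge (D := Ioo (1 / 2 : ℝ) 1 ×ˢ Ioo α β) (r₀ := 1 / 2)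
      (X := Ioo (0 : ℝ) 1 • ((fun y : sphere (0 : Ed 2) 1 => (y : Ed 2)) '' S))
      (measurableSet_Ioo.prod measurableSet_Ioo) ?_ ?_ ?_
    · refine le_trans (le_of_eq ?_) this
      rw [Measure.volume_eq_prod, Measure.prod_prod, Real.volume_Ioo, Real.volume_Ioo,
        ← ENNReal.ofReal_mul (by norm_num), ← ENNReal.ofReal_mul (by norm_num)]
      congr 1
      ring
    · rintro ⟨r, ψ⟩ ⟨hr, hψ⟩
      exact ⟨lt_trans (by norm_num) hr.1, lt_of_le_of_lt hα hψ.1, lt_of_lt_of_le hψ.2 hβ⟩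
    · rintro ⟨r, ψ⟩ ⟨hr, -⟩
      exact hr.1.le
    · rintro ⟨r, ψ⟩ ⟨hr, hψ⟩
      obtain ⟨y, hy, hyψ⟩ := h ψ hψ
      refine mem_smul.2 ⟨r, ⟨lt_trans (by norm_num) hr.1, hr.2⟩, _, ⟨y, hy, rfl⟩, ?_⟩
      ext i
      fin_cases i <;> simp [hyψ]
  have huniv : (volume : Measure (Ed 2)).toSphere univ ≤ ENNReal.ofReal 8 := by
    rw [Measure.toSphere_apply_univ, EuclideanSpace.volume_ball_fin_two]
    simp only [finrank_euclideanSpace, Fintype.card_fin, ENNReal.ofReal_one, one_pow, one_mul]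
    rw [show ((2 : ℕ) : ℝ≥0∞) = ENNReal.ofReal 2 by simp,
      ← ENNReal.ofReal_mul (by norm_num)]
    refine ENNReal.ofReal_le_ofReal ?_
    have := Real.pi_le_four
    linarith
  rw [sphereProb, Measure.smul_apply, smul_eq_mul, Measure.toSphere_apply' _ hS]
  simp only [finrank_euclideanSpace, Fintype.card_fin]
  calc ENNReal.ofReal ((β - α) / 16) = (ENNReal.ofReal 8)⁻¹ * (ENNReal.ofReal 2 *
        ENNReal.ofReal ((β - α) / 4)) := by
        rw [← ENNReal.ofReal_inv_of_pos (by norm_num), ← ENNReal.ofReal_mul (by norm_num),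
          ← ENNReal.ofReal_mul (by norm_num)]
        congr 1
        ring
    _ ≤ _ := by
        gcongr
        simp

theorem sphMean_indicator {A : Set (Ed 2)} (hA : MeasurableSet A) (t : ℝ) (x : Ed 2) :
    (‖sphMean 2 t (A.indicator fun _ => (1 : ℂ)) x‖₊ : ℝ≥0∞) =
      sphereProb 2 {y | x - t • (y : Ed 2) ∈ A} := by
  have hm : MeasurableSet {y : sphere (0 : Ed 2) 1 | x - t • (y : Ed 2) ∈ A} := by
    refine measurableSet_preimage ?_ hA
    fun_prop
  have hfin : sphereProb 2 {y : sphere (0 : Ed 2) 1 | x - t • (y : Ed 2) ∈ A} ≠ ⊤ := by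
    rw [sphereProb, Measure.smul_apply, smul_eq_mul]
    refine ENNReal.mul_ne_top (ENNReal.inv_ne_top.2 ?_) (measure_ne_top _ _)
    rw [Measure.toSphere_apply_univ, EuclideanSpace.volume_ball_fin_two]
    simp [Real.pi_pos]
  have : sphMean 2 t (A.indicator fun _ => (1 : ℂ)) x =
      ((sphereProb 2).real {y | x - t • (y : Ed 2) ∈ A} : ℂ) := by
    have h1 : (fun y : sphere (0 : Ed 2) 1 =>
        (A.indicator (fun _ => (1 : ℂ)) (x - t • (y : Ed 2)))) =
        ({y : sphere (0 : Ed 2) 1 | x - t • (y : Ed 2) ∈ A}).indicator fun _ => (1 : ℂ) := by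
      ext y
      simp [indicator]
    rw [sphMean, h1, integral_indicator_const _ hm]
    simp
  rw [this, ← enorm_eq_nnnorm, ← ofReal_norm]
  simp [Measure.real, hfin]

/-- A parallelogram with two vertical sides has measure width times height. -/
theorem volume_parallelogram (α β c d w : ℝ) (hαβ : α ≤ β) :
    volume {x : Ed 2 | x 1 ∈ Icc α β ∧ |x 0 + c * x 1 + d| ≤ w} =
      ENNReal.ofReal ((β - α) * (2 * w)) := by
  let e : (ℝ × ℝ) ≃ᵐ Ed 2 :=
    (MeasurableEquiv.finTwoArrow (α := ℝ)).symm.trans (MeasurableEquiv.toLp 2 (Fin 2 → ℝ))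
  have he : MeasurePreserving e volume volume :=
    (volume_preserving_finTwoArrow ℝ).symm.trans (PiLp.volume_preserving_toLp (Fin 2))
  rw [← he.measure_preimage_equiv]
  have hset : e ⁻¹' {x : Ed 2 | x 1 ∈ Icc α β ∧ |x 0 + c * x 1 + d| ≤ w} =
      {z : ℝ × ℝ | z.2 ∈ Icc α β ∧ |z.1 + c * z.2 + d| ≤ w} := rfl
  have hm : MeasurableSet {z : ℝ × ℝ | z.2 ∈ Icc α β ∧ |z.1 + c * z.2 + d| ≤ w} := by
    refine MeasurableSet.inter (s₁ := {z : ℝ × ℝ | z.2 ∈ Icc α β})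
      (measurable_snd measurableSet_Icc)
      (measurableSet_le (f := fun z : ℝ × ℝ => |z.1 + c * z.2 + d|) ?_ measurable_const)
    fun_prop
  rw [hset, Measure.volume_eq_prod, Measure.prod_apply_symm hm]
  have hslice : ∀ y : ℝ, volume ((fun x => (x, y)) ⁻¹'
      {z : ℝ × ℝ | z.2 ∈ Icc α β ∧ |z.1 + c * z.2 + d| ≤ w}) =
      (Icc α β).indicator (fun _ => ENNReal.ofReal (2 * w)) y := by
    intro y
    by_cases hy : y ∈ Icc α β
    · rw [indicator_of_mem hy]
      have : (fun x => (x, y)) ⁻¹' {z : ℝ × ℝ | z.2 ∈ Icc α β ∧ |z.1 + c * z.2 + d| ≤ w} =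
          Icc (-(c * y + d) - w) (-(c * y + d) + w) := by
        ext x
        simp only [mem_preimage, mem_ofPred_eq, mem_Icc, abs_le]
        refine ⟨fun h => ⟨by linarith [h.2.1], by linarith [h.2.2]⟩, fun h => ⟨hy, ?_, ?_⟩⟩ <;>
          linarith [h.1, h.2]
      rw [this, Real.volume_Icc]
      congr 1
      ring
    · rw [indicator_of_notMem hy]
      exact measure_mono_null (fun x hx => hy hx.1) measure_empty
  simp_rw [hslice]
  rw [lintegral_indicator measurableSet_Icc, setLIntegral_const, Real.volume_Icc, mul_comm,
    ← ENNReal.ofReal_mul (by linarith)]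

/-- The truncation of `τ` to its first `i` binary digits. -/
def dyadicTrunc (τ : ℝ) (i : ℕ) : ℝ := (⌊2 ^ i * τ⌋₊ : ℝ) / 2 ^ i

theorem dyadicTrunc_le {τ : ℝ} (hτ : 0 ≤ τ) (i : ℕ) : dyadicTrunc τ i ≤ τ := by
  rw [dyadicTrunc, div_le_iff₀ (by positivity), mul_comm]
  exact Nat.floor_le (by positivity)

theorem sub_dyadicTrunc_le (τ : ℝ) (i : ℕ) : τ - dyadicTrunc τ i ≤ (1 / 2) ^ i := by
  have h := (Nat.lt_floor_add_one (2 ^ i * τ)).le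
  have h2 : (0 : ℝ) < 2 ^ i := by positivity
  rw [dyadicTrunc, one_div, inv_pow, sub_le_iff_le_add, ← one_div, ← add_div, le_div_iff₀ h2]
  linarith

theorem dyadicTrunc_nonneg (τ : ℝ) (i : ℕ) : 0 ≤ dyadicTrunc τ i := by
  unfold dyadicTrunc
  positivity

theorem dyadicTrunc_dyadicTrunc (τ : ℝ) {i j : ℕ} (hij : i ≤ j) :
    dyadicTrunc (dyadicTrunc τ j) i = dyadicTrunc τ i := by
  obtain ⟨k, rfl⟩ := Nat.exists_eq_add_of_le hij
  have h1 : (2 : ℝ) ^ i * dyadicTrunc τ (i + k) = (⌊2 ^ (i + k) * τ⌋₊ : ℝ) / ((2 ^ k : ℕ) : ℝ) := by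
    rw [dyadicTrunc]
    push_cast
    rw [pow_add]
    field_simp
  have h2 : (2 : ℝ) ^ i * τ = (2 ^ (i + k) * τ) / ((2 ^ k : ℕ) : ℝ) := by
    push_cast
    rw [pow_add]
    field_simp
  rw [dyadicTrunc, h1, Nat.floor_div_natCast, Nat.floor_natCast, ← Nat.floor_div_natCast, ← h2]
  rfl

theorem dyadicTrunc_mono {τ : ℝ} {i j : ℕ} (hij : i ≤ j) : dyadicTrunc τ i ≤ dyadicTrunc τ j := by
  rw [← dyadicTrunc_dyadicTrunc τ hij]
  exact dyadicTrunc_le (dyadicTrunc_nonneg τ j) i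

theorem dyadicTrunc_sub_le {τ : ℝ} (hτ : 0 ≤ τ) (i j : ℕ) :
    dyadicTrunc τ j - dyadicTrunc τ i ≤ (1 / 2) ^ i := by
  linarith [dyadicTrunc_le hτ j, sub_dyadicTrunc_le τ i]

theorem measurable_dyadicTrunc (i : ℕ) : Measurable fun τ => dyadicTrunc τ i := by
  have : Measurable fun τ : ℝ => ⌊2 ^ i * τ⌋₊ := Nat.measurable_floor.comp (by fun_prop)
  exact (measurable_from_top.comp this).div_const _

/-- The intercept of the line of slope `dyadicTrunc τ j` in the `n`-th stage of Keich's
construction of a Besicovitch set. -/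
def keichIntercept (n j : ℕ) (τ : ℝ) : ℝ :=
  (∑ i ∈ Finset.range j, (dyadicTrunc τ j - dyadicTrunc τ i)) / n

theorem sum_half_pow_Ico_le (j m : ℕ) :
    ∑ i ∈ Finset.Ico j m, ((1 : ℝ) / 2) ^ i ≤ 2 * (1 / 2) ^ j := by
  rcases le_total j m with h | h
  · rw [geom_sum_Ico (by norm_num) h]
    have : (0 : ℝ) ≤ (1 / 2) ^ m := by positivity
    rw [show (1 : ℝ) / 2 - 1 = -(1 / 2) by norm_num, div_le_iff_of_neg (by norm_num)]
    linarith
  · rw [Finset.Ico_eq_empty_of_le h]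
    simp

theorem keichIntercept_nonneg (n j : ℕ) (τ : ℝ) : 0 ≤ keichIntercept n j τ :=
  div_nonneg (Finset.sum_nonneg fun _ hi =>
    sub_nonneg.2 (dyadicTrunc_mono (Finset.mem_range.1 hi).le)) (Nat.cast_nonneg n)

theorem keichIntercept_le {n : ℕ} (hn : 1 ≤ n) (j : ℕ) {τ : ℝ} (hτ : 0 ≤ τ) :
    keichIntercept n j τ ≤ 2 := by
  have h1 : ∑ i ∈ Finset.range j, (dyadicTrunc τ j - dyadicTrunc τ i) ≤ 2 := by
    refine (Finset.sum_le_sum fun i _ => dyadicTrunc_sub_le hτ i j).trans ?_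
    rw [Finset.range_eq_Ico]
    simpa using sum_half_pow_Ico_le 0 j
  have hn' : (1 : ℝ) ≤ n := by exact_mod_cast hn
  rw [keichIntercept, div_le_iff₀ (by linarith)]
  linarith

theorem measurable_keichIntercept (n j : ℕ) : Measurable (keichIntercept n j) := by
  unfold keichIntercept
  exact (Finset.measurable_sum _ fun i _ =>
    (measurable_dyadicTrunc j).sub (measurable_dyadicTrunc i)).div_const _

/-- On the `j`-th slab, the lines whose slopes share the first `j` binary digits stay close. -/
theorem abs_keich_line_sub_le {n j : ℕ} (hj : j < n) {τ y : ℝ} (hτ : 0 ≤ τ)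
    (hy : y ∈ Icc ((j : ℝ) / n) ((j + 1 : ℝ) / n)) :
    |(dyadicTrunc τ n * y - keichIntercept n n τ) -
      (dyadicTrunc τ j * y - keichIntercept n j τ)| ≤ 2 * (1 / 2) ^ j / n := by
  have hn : (0 : ℝ) < n := by exact_mod_cast (Nat.zero_le j).trans_lt hj
  obtain ⟨v, hv⟩ : ∃ v, v = dyadicTrunc τ n - dyadicTrunc τ j := ⟨_, rfl⟩
  have hv0 : 0 ≤ v := hv ▸ sub_nonneg.2 (dyadicTrunc_mono hj.le)
  have hv1 : v ≤ (1 / 2) ^ j := hv ▸ dyadicTrunc_sub_le hτ j n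
  obtain ⟨R, hR⟩ : ∃ R, R = ∑ i ∈ Finset.Ico j n, (dyadicTrunc τ n - dyadicTrunc τ i) := ⟨_, rfl⟩
  have hR0 : 0 ≤ R := hR ▸ Finset.sum_nonneg fun i hi =>
    sub_nonneg.2 (dyadicTrunc_mono (Finset.mem_Ico.1 hi).2.le)
  have hR1 : R ≤ 2 * (1 / 2) ^ j := hR ▸
    (Finset.sum_le_sum fun i _ => dyadicTrunc_sub_le hτ i n).trans (sum_half_pow_Ico_le j n)
  have hsplit : keichIntercept n n τ - keichIntercept n j τ = (j * v + R) / n := by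
    rw [keichIntercept, keichIntercept, ← sub_div,
      ← Finset.sum_range_add_sum_Ico (fun i => dyadicTrunc τ n - dyadicTrunc τ i) hj.le]
    have : ∑ i ∈ Finset.range j, (dyadicTrunc τ n - dyadicTrunc τ i) =
        j * v + ∑ i ∈ Finset.range j, (dyadicTrunc τ j - dyadicTrunc τ i) := by
      rw [hv, ← nsmul_eq_mul, ← Finset.card_range j, ← Finset.sum_const, Finset.card_range,
        ← Finset.sum_add_distrib]
      exact Finset.sum_congr rfl fun i _ => by ring
    rw [this, ← hR]
    congr 1
    ring
  have hid : (dyadicTrunc τ n * y - keichIntercept n n τ) -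
      (dyadicTrunc τ j * y - keichIntercept n j τ) = v * (y - j / n) - R / n := by
    have : (dyadicTrunc τ n * y - keichIntercept n n τ) -
      (dyadicTrunc τ j * y - keichIntercept n j τ) =
        v * y - (keichIntercept n n τ - keichIntercept n j τ) := by
      linear_combination (-y) * hv
    rw [this, hsplit]
    ring
  have h1 : 0 ≤ v * (y - j / n) := mul_nonneg hv0 (by linarith [hy.1])
  have h2 : v * (y - j / n) ≤ (1 / 2) ^ j * (1 / n) := by
    refine mul_le_mul hv1 ?_ (by linarith [hy.1]) (by positivity)
    have := hy.2
    rw [add_div] at this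
    linarith
  have h3 : 0 ≤ R / n := by positivity
  have h4 : R / n ≤ 2 * (1 / 2) ^ j / n := by gcongr
  have h5 : ((1 : ℝ) / 2) ^ j * (1 / n) ≤ 2 * (1 / 2) ^ j / n := by
    rw [mul_one_div]
    gcongr
    have : (0 : ℝ) ≤ (1 / 2) ^ j := by positivity
    linarith
  rw [hid, abs_le]
  constructor <;> linarith

/-- One parallelogram of the Besicovitch-type set `keichSet`. -/
def keichPiece (n : ℕ) (L : ℝ) (j h : ℕ) : Set (Ed 2) :=
  {x | x 1 ∈ Icc (L * (j / n)) (L * ((j + 1) / n)) ∧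
    |x 0 + dyadicTrunc (h / 2 ^ j) j * x 1 + -(L * keichIntercept n j (h / 2 ^ j))| ≤
      L * (2 * (1 / 2) ^ j / n + 2 * (1 / 2) ^ n)}

/-- A set of small measure that contains, for each `τ ∈ [0,1)`, a strip of length `L` and width
comparable to `L * 2⁻ⁿ` whose slope is `-τ` up to an error `2⁻ⁿ`. -/
def keichSet (n : ℕ) (L : ℝ) : Set (Ed 2) :=
  ⋃ j ∈ Finset.range n, ⋃ h ∈ Finset.range (2 ^ j), keichPiece n L j h

theorem measurableSet_keichSet (n : ℕ) (L : ℝ) : MeasurableSet (keichSet n L) := by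
  have hm : ∀ c d w : ℝ, MeasurableSet {x : Ed 2 | |x 0 + c * x 1 + d| ≤ w} := fun c d w =>
    measurableSet_le (by fun_prop) measurable_const
  refine Finset.measurableSet_biUnion _ fun j _ => Finset.measurableSet_biUnion _ fun h _ => ?_
  refine MeasurableSet.inter (s₁ := {x : Ed 2 | x 1 ∈ Icc (L * (j / n)) (L * ((j + 1) / n))})
    (measurableSet_preimage (f := fun x : Ed 2 => x 1) (by fun_prop) measurableSet_Icc)
    (hm _ _ _)

theorem volume_keichPiece (n : ℕ) {L : ℝ} (hL : 0 ≤ L) (j h : ℕ) :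
    volume (keichPiece n L j h) =
      ENNReal.ofReal (2 * L ^ 2 / n * (2 * (1 / 2) ^ j / n + 2 * (1 / 2) ^ n)) := by
  rw [keichPiece, volume_parallelogram]
  · congr 1
    ring
  · gcongr
    linarith

theorem volume_keichSet_le {n : ℕ} (hn : 1 ≤ n) {L : ℝ} (hL : 0 ≤ L) :
    volume (keichSet n L) ≤ ENNReal.ofReal (8 * L ^ 2 / n) := by
  have hn' : (0 : ℝ) < n := by exact_mod_cast hn
  have hj : ∀ j ∈ Finset.range n, volume (⋃ h ∈ Finset.range (2 ^ j), keichPiece n L j h) ≤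
      ENNReal.ofReal (2 * L ^ 2 / n * (2 / n + 2 * (2 ^ j * (1 / 2) ^ n))) := by
    intro j _
    refine (measure_biUnion_finset_le _ _).trans ?_
    simp_rw [volume_keichPiece n hL]
    rw [Finset.sum_const, Finset.card_range, nsmul_eq_mul, ← ENNReal.ofReal_natCast,
      ← ENNReal.ofReal_mul (by positivity)]
    refine ENNReal.ofReal_le_ofReal (le_of_eq ?_)
    have : (2 : ℝ) ^ j * (1 / 2) ^ j = 1 := by rw [← mul_pow]; norm_num
    push_cast
    linear_combination (2 * L ^ 2 / n * (2 / n)) * this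
  refine (measure_biUnion_finset_le _ _).trans ((Finset.sum_le_sum hj).trans ?_)
  rw [← ENNReal.ofReal_sum_of_nonneg fun _ _ => by positivity]
  refine ENNReal.ofReal_le_ofReal ?_
  rw [← Finset.mul_sum, Finset.sum_add_distrib, ← Finset.mul_sum, ← Finset.sum_mul,
    geom_sum_eq (by norm_num)]
  have h1 : ((2 : ℝ) ^ n) * (1 / 2) ^ n = 1 := by rw [← mul_pow]; norm_num
  have h2 : ∑ _i ∈ Finset.range n, (2 : ℝ) / n = 2 := by
    rw [Finset.sum_const, Finset.card_range, nsmul_eq_mul]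
    field_simp
  rw [h2]
  have h3 : (2 : ℝ) + 2 * ((2 ^ n - 1) / (2 - 1) * (1 / 2) ^ n) ≤ 4 := by
    have : (0 : ℝ) ≤ (1 / 2) ^ n := by positivity
    linarith
  calc 2 * L ^ 2 / n * (2 + 2 * ((2 ^ n - 1) / (2 - 1) * (1 / 2) ^ n)) ≤ 2 * L ^ 2 / n * 4 := by
        gcongr
    _ = 8 * L ^ 2 / n := by ring

theorem mem_keichSet {n : ℕ} (hn1 : 1 ≤ n) {L : ℝ} (hL : 0 < L) {τ : ℝ} (hτ0 : 0 ≤ τ)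
    (hτ1 : τ < 1) {x : Ed 2} (hx0 : 0 ≤ x 1) (hxL : x 1 < L)
    (hx : |x 0 + dyadicTrunc τ n * x 1 - L * keichIntercept n n τ| ≤ 2 * L * (1 / 2) ^ n) :
    x ∈ keichSet n L := by
  have hn : (0 : ℝ) < n := by exact_mod_cast hn1
  set y := x 1 / L with hy
  have hxy : x 1 = L * y := by rw [hy]; field_simp
  have hy0 : 0 ≤ y := by positivity
  have hy1 : y < 1 := by rw [hy, div_lt_one hL]; exact hxL
  set j := ⌊n * y⌋₊ with hj
  have hjy : (j : ℝ) ≤ n * y := Nat.floor_le (by positivity)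
  have hyj : n * y < j + 1 := Nat.lt_floor_add_one _
  have hjn : j < n := by
    have : (j : ℝ) < n := by nlinarith
    exact_mod_cast this
  have hyI : y ∈ Icc ((j : ℝ) / n) ((j + 1 : ℝ) / n) := by
    rw [mem_Icc, div_le_iff₀ hn, le_div_iff₀ hn]
    constructor <;> linarith
  have hclose := abs_keich_line_sub_le hjn hτ0 hyI
  refine mem_iUnion₂.2 ⟨j, Finset.mem_range.2 hjn, mem_iUnion₂.2
    ⟨⌊2 ^ j * τ⌋₊, Finset.mem_range.2 ?_, ?_, ?_⟩⟩
  · rw [Nat.floor_lt (by positivity)]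
    push_cast
    have : (0 : ℝ) < 2 ^ j := by positivity
    nlinarith
  · rw [hxy]
    exact ⟨mul_le_mul_of_nonneg_left hyI.1 hL.le, mul_le_mul_of_nonneg_left hyI.2 hL.le⟩
  · have htrunc : (⌊2 ^ j * τ⌋₊ : ℝ) / 2 ^ j = dyadicTrunc τ j := rfl
    have hint : keichIntercept n j (dyadicTrunc τ j) = keichIntercept n j τ := by
      unfold keichIntercept
      rw [dyadicTrunc_dyadicTrunc τ le_rfl]
      congr 1
      exact Finset.sum_congr rfl fun i hi => by
        rw [dyadicTrunc_dyadicTrunc τ (Finset.mem_range.1 hi).le]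
    rw [htrunc, hint, dyadicTrunc_dyadicTrunc τ le_rfl]
    rw [hxy] at hx ⊢
    rw [abs_le] at hx hclose ⊢
    have h1 := mul_le_mul_of_nonneg_left hclose.1 hL.le
    have h2 := mul_le_mul_of_nonneg_left hclose.2 hL.le
    constructor <;> linarith [hx.1, hx.2]

/-- Points of the circle of radius `t` about `s (cos θ, sin θ)` that are seen from the center
under an angle slightly smaller than `θ` lie in the strip of slope `-tan θ` of `keichSet`. -/
theorem circle_point_mem_keichSet {n : ℕ} (hn : 1 ≤ n) {T t r s θ φ : ℝ} (hT : 0 < T) (ht : T ≤ t)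
    (ht' : t ≤ 2 * T) (hθ : 0 < θ) (hθ' : θ < 1 / 4) (hφ : (1 / 2) ^ n / 2 < φ)
    (hφ' : φ < (1 / 2) ^ n) (hr : |r - t| ≤ T * ((1 / 2) ^ n) ^ 2)
    (hs : s = r + 16 * T * (1 / 2) ^ n * keichIntercept n n (Real.tan θ) * Real.cos θ)
    {x : Ed 2} (hx0 : x 0 = s * Real.cos θ - t * Real.cos (θ - φ))
    (hx1 : x 1 = s * Real.sin θ - t * Real.sin (θ - φ)) :
    x ∈ keichSet n (16 * T * (1 / 2) ^ n) := by
  have hε0 : (0 : ℝ) < (1 / 2) ^ n := by positivity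
  have hε1 : ((1 : ℝ) / 2) ^ n ≤ 1 / 2 := by
    simpa using pow_le_pow_of_le_one (by norm_num : (0 : ℝ) ≤ 1 / 2) (by norm_num) hn
  have hφ0 : 0 < φ := by linarith
  have hS0 : 0 < Real.sin θ := Real.sin_pos_of_pos_of_lt_pi hθ (by linarith [Real.pi_gt_three])
  have hS1 : Real.sin θ ≤ 1 / 4 := (Real.sin_lt hθ).le.trans hθ'.le
  have hC1 : Real.cos θ ≤ 1 := Real.cos_le_one θ
  have hC0 : 31 / 32 ≤ Real.cos θ := by
    have := Real.one_sub_sq_div_two_le_cos (x := θ)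
    nlinarith
  have htan : Real.tan θ * Real.cos θ = Real.sin θ :=
    Real.tan_mul_cos (by linarith)
  have hτ0 : 0 ≤ Real.tan θ := by nlinarith
  have hτ1 : Real.tan θ < 1 := by nlinarith
  have hsq := Real.sin_sq_add_cos_sq θ
  have hu0 := dyadicTrunc_le hτ0 n
  have hu1 := sub_dyadicTrunc_le (Real.tan θ) n
  have hb0 := keichIntercept_nonneg n n (Real.tan θ)
  have hb2 := keichIntercept_le hn n hτ0
  have hsφ : Real.sin φ ≤ φ := (Real.sin_lt hφ0).le
  have hsφ' : φ * (15 / 16) ≤ Real.sin φ := by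
    have := Real.sin_gt_sub_cube hφ0
    have h2 : φ ^ 2 ≤ 1 / 4 := by nlinarith
    nlinarith
  have hcφ : 0 ≤ 1 - Real.cos φ := by linarith [Real.cos_le_one φ]
  have hcφ' : 1 - Real.cos φ ≤ φ ^ 2 / 2 := by
    linarith [Real.one_sub_sq_div_two_le_cos (x := φ)]
  suffices h : 0 ≤ x 1 ∧ x 1 < 16 * T * (1 / 2) ^ n ∧ |x 0 + dyadicTrunc (Real.tan θ) n * x 1 -
      16 * T * (1 / 2) ^ n * keichIntercept n n (Real.tan θ)| ≤
        2 * (16 * T * (1 / 2) ^ n) * (1 / 2) ^ n from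
    mem_keichSet hn (by positivity) hτ0 hτ1 h.1 h.2.1 h.2.2
  rw [Real.cos_sub] at hx0
  rw [Real.sin_sub] at hx1
  generalize Real.sin θ = S at *
  generalize Real.cos θ = C at *
  generalize Real.tan θ = τ at *
  generalize Real.sin φ = sφ at *
  generalize Real.cos φ = cφ at *
  generalize (1 / 2 : ℝ) ^ n = ε at *
  generalize keichIntercept n n τ = b at *
  generalize dyadicTrunc τ n = u at *
  generalize x 0 = q at *
  generalize x 1 = p at *
  have hp : p = (r - t) * S + t * (S * (1 - cφ) + C * sφ) + 16 * T * ε * (b * C * S) := by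
    rw [hx1, hs]
    ring
  have hε2 : ε ^ 2 ≤ ε / 2 := by
    rw [sq]
    linarith [mul_le_mul_of_nonneg_left hε1 hε0.le]
  have hTε : 0 < T * ε := by positivity
  have hTε2 : T * ε ^ 2 ≤ T * ε / 2 := by linarith [mul_le_mul_of_nonneg_left hε2 hT.le]
  obtain ⟨hr1, hr2⟩ := abs_le.1 hr
  have hA : |(r - t) * S| ≤ T * ε / 8 := by
    rw [abs_mul, abs_of_pos hS0]
    calc |r - t| * S ≤ T * ε ^ 2 * (1 / 4) := by gcongr
      _ ≤ T * ε / 8 := by linarith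
  obtain ⟨hA1, hA1'⟩ := abs_le.1 hA
  have hw0 : ε * (9 / 20) ≤ S * (1 - cφ) + C * sφ := by
    have h1 : 0 ≤ S * (1 - cφ) := by positivity
    have h2 : 31 / 32 * (φ * (15 / 16)) ≤ C * sφ := by gcongr
    linarith
  have hw1 : S * (1 - cφ) + C * sφ ≤ ε * (5 / 4) := by
    have h1 : S * (1 - cφ) ≤ 1 / 4 * (φ ^ 2 / 2) := by gcongr
    have h2 : C * sφ ≤ 1 * φ := by
      have : 0 ≤ sφ := by linarith
      gcongr
    have h3 : φ ^ 2 ≤ ε ^ 2 := by gcongr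
    linarith
  have hA2 : T * (ε * (9 / 20)) ≤ t * (S * (1 - cφ) + C * sφ) := by
    have : 0 ≤ t := by linarith only [hT, ht]
    gcongr
  have hA2' : t * (S * (1 - cφ) + C * sφ) ≤ 2 * T * (ε * (5 / 4)) := by
    have : 0 ≤ S * (1 - cφ) + C * sφ := by linarith
    gcongr
  have hA3 : 0 ≤ 16 * T * ε * (b * C * S) := by
    have : 0 ≤ C := by linarith
    positivity
  have hA3' : 16 * T * ε * (b * C * S) ≤ 16 * T * ε * (2 * 1 * (1 / 4)) := by
    have : 0 ≤ C := by linarith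
    gcongr
  have hp0 : 0 ≤ p := by linarith only [hp, hA1, hA2, hA3, hTε]
  have hpL : p < 16 * T * ε := by linarith only [hp, hA1', hA2', hA3', hTε]
  refine ⟨hp0, hpL, ?_⟩
  have hE : (q + τ * p - 16 * T * ε * b) * C = (r - t) + t * (1 - cφ) := by
    linear_combination C * hx0 + S * hx1 + p * htan + (s - t * cφ) * hsq + hs
  have hE2 : |(q + τ * p - 16 * T * ε * b) * C| ≤ 2 * (T * ε ^ 2) := by
    have h1 : t * (1 - cφ) ≤ 2 * T * (ε ^ 2 / 2) := by
      have : 1 - cφ ≤ ε ^ 2 / 2 := hcφ'.trans (by gcongr)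
      gcongr
    have h2 : 0 ≤ t * (1 - cφ) := by
      have : 0 < t := by linarith
      positivity
    rw [hE, abs_le]
    constructor <;> linarith
  have hE3 : |q + τ * p - 16 * T * ε * b| ≤ 3 * (T * ε ^ 2) := by
    rw [abs_mul, abs_of_nonneg (by linarith : 0 ≤ C)] at hE2
    have := mul_le_mul_of_nonneg_left hC0 (abs_nonneg (q + τ * p - 16 * T * ε * b))
    linarith
  have hF0 : 0 ≤ (τ - u) * p := mul_nonneg (by linarith) hp0
  have hF1 : (τ - u) * p ≤ ε * (16 * T * ε) := by gcongr
  have hTε3 : 0 ≤ T * ε ^ 2 := by positivity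
  rw [abs_le] at hE3 ⊢
  constructor <;> linarith

/-- The union of the cells of the grid `η ℤ` that meet `S`. -/
def gridNeighborhood (S : Set ℝ) (η : ℝ) : Set ℝ := {s | ∃ t ∈ S, ⌊t / η⌋ = ⌊s / η⌋}

theorem measurableSet_gridNeighborhood (S : Set ℝ) (η : ℝ) :
    MeasurableSet (gridNeighborhood S η) := by
  have : gridNeighborhood S η = (fun s : ℝ => ⌊s / η⌋) ⁻¹' ((fun t : ℝ => ⌊t / η⌋) '' S) := rfl
  rw [this]
  exact (Int.measurable_floor.comp (measurable_id.div_const η)) (MeasurableSpace.measurableSet_top)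

theorem covN_mul_le_volume {S : Set ℝ} (hS : S.Nonempty) {a b η : ℝ} (hSb : S ⊆ Icc a b)
    (hη : 0 < η) : ENNReal.ofReal (covN S η * η) ≤ volume (gridNeighborhood S η) := by
  have hcell : ∀ (j : ℤ) (s : ℝ), ⌊s / η⌋ = j ↔ s ∈ Ico (j * η) (j * η + η) := by
    intro j s
    rw [Int.floor_eq_iff, le_div_iff₀ hη, div_lt_iff₀ hη, add_mul, one_mul]
    rfl
  have hfin : ((fun t : ℝ => ⌊t / η⌋) '' S).Finite := by
    refine (Set.finite_Icc ⌊a / η⌋ ⌊b / η⌋).subset ?_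
    rintro _ ⟨t, ht, rfl⟩
    have := hSb ht
    exact ⟨Int.floor_le_floor (by gcongr; exact this.1),
      Int.floor_le_floor (by gcongr; exact this.2)⟩
  set J := hfin.toFinset with hJ
  have hJpos : 1 ≤ J.card := by
    rw [Nat.one_le_iff_ne_zero, Finset.card_ne_zero, hJ, Set.Finite.toFinset_nonempty]
    exact hS.image _
  have hcov : covN S η ≤ J.card := by
    refine max_le hJpos (Nat.sInf_le ⟨fun i => (J.equivFin.symm i : ℤ) * η, fun t ht => ?_⟩)
    have htJ : ⌊t / η⌋ ∈ J := hfin.mem_toFinset.2 ⟨t, ht, rfl⟩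
    refine mem_iUnion.2 ⟨J.equivFin ⟨_, htJ⟩, ?_⟩
    simp only [Equiv.symm_apply_apply]
    exact Ico_subset_Icc_self ((hcell _ t).1 rfl)
  have hU : ⋃ j ∈ J, Ico (j * η : ℝ) (j * η + η) ⊆ gridNeighborhood S η := by
    refine iUnion₂_subset fun j hj s hs => ?_
    obtain ⟨t, ht, htj⟩ := hfin.mem_toFinset.1 hj
    exact ⟨t, ht, htj.trans ((hcell j s).2 hs).symm⟩
  refine le_trans ?_ (measure_mono hU)
  rw [measure_biUnion_finset]
  · simp only [Real.volume_Ico, add_sub_cancel_left]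
    rw [Finset.sum_const, nsmul_eq_mul, ← ENNReal.ofReal_natCast,
      ← ENNReal.ofReal_mul (by positivity)]
    gcongr
  · intro i _ j _ hij
    refine Set.disjoint_left.2 fun s hs hs' => hij ?_
    rw [← (hcell i s).2 hs, (hcell j s).2 hs']
  · exact fun _ _ => measurableSet_Ico

/-- The maximal function of `keichSet` is large on a set of measure comparable to
`T` times that of the grid neighborhood of `S`. -/
theorem volume_maxFn_keichSet_ge {E S : Set ℝ} {n : ℕ} (hn : 1 ≤ n) {T η : ℝ} (hT : 0 < T)
    (hSE : S ⊆ E) (hST : S ⊆ Icc T (2 * T)) (hη : 0 < η) (hη' : η ≤ T * ((1 / 2) ^ n) ^ 2) :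
    ENNReal.ofReal (T / 8) * volume (gridNeighborhood S η) ≤
      volume {x | ENNReal.ofReal ((1 / 2) ^ n / 64) < maxFn 2 E
        ((keichSet n (16 * T * (1 / 2) ^ n)).indicator fun _ => (1 : ℂ)) x} := by
  have hε0 : (0 : ℝ) < (1 / 2) ^ n := by positivity
  have hε1 : ((1 : ℝ) / 2) ^ n ≤ 1 / 2 := by
    simpa using pow_le_pow_of_le_one (by norm_num : (0 : ℝ) ≤ 1 / 2) (by norm_num) hn
  have hηT : η ≤ T / 2 := by
    have h : ((1 / 2 : ℝ) ^ n) ^ 2 ≤ 1 / 2 := by nlinarith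
    linarith [mul_le_mul_of_nonneg_left h hT.le]
  let β : ℝ → ℝ := fun θ =>
    16 * T * (1 / 2) ^ n * keichIntercept n n (Real.tan θ) * Real.cos θ
  have hβm : Measurable β := by
    have h1 : Measurable Real.tan := by
      rw [show Real.tan = fun x => Real.sin x / Real.cos x from funext Real.tan_eq_sin_div_cos]
      exact Real.measurable_sin.div Real.measurable_cos
    exact (((measurable_keichIntercept n n).comp h1).const_mul _).mul Real.measurable_cos
  let D : Set (ℝ × ℝ) := {z | z.2 ∈ Ioo 0 (1 / 4) ∧ z.1 - β z.2 ∈ gridNeighborhood S η}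
  have hD : MeasurableSet D :=
    MeasurableSet.inter (s₁ := {z : ℝ × ℝ | z.2 ∈ Ioo 0 (1 / 4)})
      (measurable_snd measurableSet_Ioo)
      ((measurable_fst.sub (hβm.comp measurable_snd)) (measurableSet_gridNeighborhood S η))
  have hvol : volume D = volume (gridNeighborhood S η) * ENNReal.ofReal (1 / 4) := by
    rw [Measure.volume_eq_prod, Measure.prod_apply_symm hD]
    have hslice : ∀ θ : ℝ, volume ((fun s => (s, θ)) ⁻¹' D) =
        (Ioo (0 : ℝ) (1 / 4)).indicator (fun _ => volume (gridNeighborhood S η)) θ := by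
      intro θ
      by_cases hθ : θ ∈ Ioo (0 : ℝ) (1 / 4)
      · have : (fun s => (s, θ)) ⁻¹' D = (fun s => s + -β θ) ⁻¹' gridNeighborhood S η := by
          ext s
          exact ⟨fun h => h.2, fun h => ⟨hθ, h⟩⟩
        rw [indicator_of_mem hθ, this, measure_preimage_add_right]
      · rw [indicator_of_notMem hθ]
        exact measure_mono_null (fun x hx => hθ hx.1) measure_empty
    simp_rw [hslice]
    rw [lintegral_indicator measurableSet_Ioo, setLIntegral_const, Real.volume_Ioo, sub_zero]
  have hmem : ∀ z ∈ D, ∃ t ∈ S, |z.1 - β z.2 - t| ≤ η := by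
    rintro z ⟨-, t, ht, hfl⟩
    refine ⟨t, ht, ?_⟩
    have h1 := (Int.abs_sub_lt_one_of_floor_eq_floor hfl.symm).le
    rw [← sub_div, abs_div, abs_of_pos hη, div_le_one hη] at h1
    exact h1
  have hlow : ∀ z ∈ D, T / 2 ≤ z.1 := by
    intro z hz
    obtain ⟨t, ht, htz⟩ := hmem z hz
    have hcos : 0 ≤ Real.cos z.2 := Real.cos_nonneg_of_neg_pi_div_two_le_of_le
      (by linarith [hz.1.1, Real.pi_gt_three]) (by linarith [hz.1.2, Real.pi_gt_three])
    have hβ0 : 0 ≤ β z.2 :=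
      mul_nonneg (mul_nonneg (by positivity) (keichIntercept_nonneg n n _)) hcos
    linarith [(abs_le.1 htz).1, (hST ht).1]
  have key := volume_polar_image_ge hD (r₀ := T / 2) (X := {x | ENNReal.ofReal ((1 / 2) ^ n / 64) <
    maxFn 2 E ((keichSet n (16 * T * (1 / 2) ^ n)).indicator fun _ => (1 : ℂ)) x}) ?_ hlow ?_
  · refine le_trans (le_of_eq ?_) key
    rw [hvol, mul_comm (volume _), ← mul_assoc, ← ENNReal.ofReal_mul (by positivity)]
    congr 2
    ring
  · intro z hz
    have := hlow z hz
    exact ⟨show 0 < z.1 by linarith, show -Real.pi < z.2 by linarith [hz.1.1, Real.pi_pos],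
      show z.2 < Real.pi by linarith [hz.1.2, Real.pi_gt_three]⟩
  · rintro ⟨s, θ⟩ hz
    obtain ⟨t, ht, htz⟩ := hmem _ hz
    obtain ⟨hθ0, hθ1⟩ : 0 < θ ∧ θ < 1 / 4 := hz.1
    have harc := sphereProb_arc_ge (α := θ - (1 / 2) ^ n) (β := θ - (1 / 2) ^ n / 2)
      (S := {y : sphere (0 : Ed 2) 1 | (!₂[s * Real.cos θ, s * Real.sin θ] : Ed 2) - t • (y : Ed 2) ∈
        keichSet n (16 * T * (1 / 2) ^ n)})
      (measurableSet_preimage (by fun_prop) (measurableSet_keichSet _ _))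
      (by linarith [Real.pi_gt_three]) (by linarith [Real.pi_gt_three]) ?_
    · have hlt : ENNReal.ofReal ((1 / 2) ^ n / 64) <
          ENNReal.ofReal ((θ - (1 / 2) ^ n / 2 - (θ - (1 / 2) ^ n)) / 16) := by
        refine (ENNReal.ofReal_lt_ofReal_iff (by linarith)).2 (by linarith)
      refine hlt.trans_le (harc.trans ?_)
      rw [← sphMean_indicator (measurableSet_keichSet _ _)]
      exact le_iSup₂ (f := fun t _ => (‖sphMean 2 t ((keichSet n (16 * T * (1 / 2) ^ n)).indicator
        fun _ => (1 : ℂ)) !₂[s * Real.cos θ, s * Real.sin θ]‖₊ : ℝ≥0∞)) t (hSE ht)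
    · intro ψ hψ
      have hy : (!₂[Real.cos ψ, Real.sin ψ] : Ed 2) ∈ sphere (0 : Ed 2) 1 := by
        rw [mem_sphere_zero_iff_norm, EuclideanSpace.norm_eq]
        simp
      refine ⟨⟨_, hy⟩, ?_, rfl⟩
      refine circle_point_mem_keichSet hn hT (hST ht).1 (hST ht).2 hθ0 hθ1 (φ := θ - ψ)
        (by linarith [hψ.2]) (by linarith [hψ.1]) (htz.trans hη') (s := s) ?_ ?_ ?_
      · simp [β]
      · simp
      · simp

/-- Proposition 1.5: in two dimensions, if
`sup_{k>0} sup_{0<δ<1/10} N(E^k, 2^k δ) δ log(1/δ) = ∞` then `M_E` is not of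
restricted weak type `(2,2)`. -/
theorem circular_maximal_not_restricted_weak_type (E : Set ℝ) (hE : E ⊆ Set.Ioi (0:ℝ))
    (hbig : ∀ B : ℝ, ∃ (k : ℤ) (δ : ℝ), 0 < k ∧ 0 < δ ∧ δ < 1/10 ∧
      B < (covN (Ek E k) ((2:ℝ) ^ k * δ) : ℝ) * δ * Real.log (1/δ)) :
    ¬ ∃ C : ℝ, ∀ A : Set (Ed 2), MeasurableSet A → volume A < ⊤ → ∀ a : ℝ, 0 < a →
        volume {x | ENNReal.ofReal a < maxFn 2 E (A.indicator fun _ => (1:ℂ)) x} ≤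
          ENNReal.ofReal (C * a ^ (-(2:ℝ))) * volume A := by
  rintro ⟨C, hC⟩
  obtain ⟨k, δ, -, hδ0, hδ1, hB⟩ := hbig (2 ^ 28 * |C| + 1)
  have hT : (0 : ℝ) < 2 ^ k := by positivity
  have hδlog : δ * Real.log (1 / δ) ≤ 1 := by
    have h1 : Real.log (1 / δ) ≤ 1 / δ := (Real.log_le_sub_one_of_pos (by positivity)).trans (by simp)
    calc δ * Real.log (1 / δ) ≤ δ * (1 / δ) := by gcongr
      _ = 1 := by field_simp
  have hne : (Ek E k).Nonempty := by
    by_contra hempty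
    rw [not_nonempty_iff_eq_empty] at hempty
    have hcov : covN (Ek E k) (2 ^ k * δ) = 1 := by
      have : sInf {n : ℕ | ∃ c : Fin n → ℝ, Ek E k ⊆ ⋃ i, Icc (c i) (c i + 2 ^ k * δ)} ≤ 0 :=
        Nat.sInf_le ⟨fun _ => 0, by simp [hempty]⟩
      exact max_eq_left (this.trans zero_le_one)
    rw [hcov] at hB
    have : 0 ≤ 2 ^ 28 * |C| := by positivity
    push_cast at hB
    linarith
  have hST : Ek E k ⊆ Icc (2 ^ k) (2 * 2 ^ k) := by
    intro t ht
    have h2 := ht.2.2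
    rw [zpow_add_one₀ (by norm_num)] at h2
    exact ⟨ht.2.1, by linarith⟩
  obtain ⟨n, hn1, hn2⟩ := exists_nat_pow_near_of_lt_one hδ0 (by linarith : δ ≤ 1)
    (by norm_num : (0 : ℝ) < 1 / 4) (by norm_num)
  have hn : 1 ≤ n := by
    rw [Nat.one_le_iff_ne_zero]
    rintro rfl
    norm_num at hn1
    linarith
  have hε : (((1 : ℝ) / 2) ^ n) ^ 2 = (1 / 4) ^ n := by
    rw [← pow_mul, mul_comm, pow_mul]
    norm_num
  have hn' : (1 : ℝ) ≤ n := by exact_mod_cast hn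
  obtain ⟨T, hTk⟩ : ∃ T : ℝ, T = 2 ^ k := ⟨_, rfl⟩
  obtain ⟨N, hN⟩ : ∃ N : ℝ, N = covN (Ek E k) (2 ^ k * δ) := ⟨_, rfl⟩
  have hN0 : 0 ≤ N := hN ▸ Nat.cast_nonneg _
  have hlow := volume_maxFn_keichSet_ge (E := E) hn hT (fun t ht => ht.1) hST
    (by positivity : 0 < 2 ^ k * δ) (by rw [hε]; gcongr)
  have hcov := covN_mul_le_volume hne hST (by positivity : 0 < 2 ^ k * δ)
  have hvolA := volume_keichSet_le hn (by positivity : (0 : ℝ) ≤ 16 * 2 ^ k * (1 / 2) ^ n)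
  have hup := hC _ (measurableSet_keichSet n (16 * 2 ^ k * (1 / 2) ^ n))
    (hvolA.trans_lt ENNReal.ofReal_lt_top) ((1 / 2) ^ n / 64) (by positivity)
  rw [← hN] at hB hcov
  rw [← hTk] at hlow hcov hvolA hup hT
  have hchain : ENNReal.ofReal (T / 8 * (N * (T * δ))) ≤
      ENNReal.ofReal (|C| * ((1 / 2) ^ n / 64) ^ (-(2 : ℝ)) *
        (8 * (16 * T * (1 / 2) ^ n) ^ 2 / n)) := by
    rw [ENNReal.ofReal_mul (by positivity : 0 ≤ T / 8), ENNReal.ofReal_mul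
      (by positivity : 0 ≤ |C| * ((1 / 2) ^ n / 64) ^ (-(2 : ℝ)))]
    refine ((mul_le_mul_right hcov _).trans (hlow.trans hup)).trans ?_
    gcongr
    exact le_abs_self C
  rw [ENNReal.ofReal_le_ofReal_iff (by positivity), Real.rpow_neg (by positivity),
    Real.rpow_two] at hchain
  have hchain2 : T ^ 2 * (N * δ) ≤ T ^ 2 * (2 ^ 26 * |C| / n) := by
    have h1 : |C| * (((1 / 2) ^ n / 64) ^ 2)⁻¹ * (8 * (16 * T * (1 / 2) ^ n) ^ 2 / n) =
        T ^ 2 * (2 ^ 23 * |C| / n) := by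
      have : ((1 : ℝ) / 2) ^ n ≠ 0 := by positivity
      field_simp
      ring
    rw [h1] at hchain
    have h2 : T ^ 2 * (2 ^ 26 * |C| / n) = 8 * (T ^ 2 * (2 ^ 23 * |C| / n)) := by ring
    rw [h2]
    linarith
  have hNδ : N * δ * n ≤ 2 ^ 26 * |C| := by
    have := le_of_mul_le_mul_left hchain2 (by positivity)
    rwa [le_div_iff₀ (by linarith)] at this
  have hlog : Real.log (1 / δ) ≤ 4 * n := by
    have h1 : 1 / δ ≤ 4 ^ (n + 1) := by
      rw [div_le_iff₀ hδ0]
      have h2 : (4 : ℝ) ^ (n + 1) * (1 / 4) ^ (n + 1) = 1 := by rw [← mul_pow]; norm_num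
      nlinarith [show (0 : ℝ) < 4 ^ (n + 1) by positivity]
    have h3 := Real.log_le_log (by positivity) h1
    rw [Real.log_pow, show (4 : ℝ) = 2 ^ 2 by norm_num, Real.log_pow] at h3
    push_cast at h3
    have h4 := Real.log_two_lt_d9
    nlinarith
  have hfin : N * δ * Real.log (1 / δ) ≤ 4 * (N * δ * n) := by
    have := mul_le_mul_of_nonneg_left hlog (by positivity : 0 ≤ N * δ)
    linarith
  have : 0 ≤ |C| := abs_nonneg C
  linarith
end
end

section
/- For every M > d there is a constant C_M (depending only on d, M, and β_0) such that for all k ∈ ℤ, all j ≥ 10, all t ∈ [2^k, 2^{k+1}], every Schwartz function f on ℝ^d, and every x ∈ ℝ^d: |A_t^j f(x)| + 2^{−j} t |B_t^j f(x)| ≤ C_M 2^j ∫_{ℝ^d} t^{−d} (1 + 2^j | |x−y|/t − 1 |)^{−M} |f(y)| dy. -/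
open MeasureTheory Metric Set Filter
open scoped ENNReal NNReal Topology RealInnerProductSpace

noncomputable section

def eChar (r : ℝ) : ℂ := Complex.exp ((r : ℂ) * Complex.I)

/-- The Fourier transform `\widehat{dσ}` of the sphere measure. -/
def sigmaHat (d : ℕ) (ξ : Ed d) : ℂ :=
  ∫ y : sphere (0 : Ed d) 1, eChar (-(2 * Real.pi * ⟪ξ, (y : Ed d)⟫)) ∂(sphereProb d)

/-- The Fourier transform `\hat f`. -/
def fourierInt (d : ℕ) (f : Ed d → ℂ) (ξ : Ed d) : ℂ :=
  ∫ x : Ed d, eChar (-(2 * Real.pi * ⟪ξ, x⟫)) * f x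

/-- `β₀ ∈ C_c^∞` is radial, `≡ 1` on `{|ξ| ≤ 1}` and `≡ 0` on `{|ξ| ≥ 2}`. -/
def IsAdmissibleBump (d : ℕ) (β0 : Ed d → ℝ) : Prop :=
  ContDiff ℝ (⊤ : ℕ∞) β0 ∧ HasCompactSupport β0 ∧
  (∀ ξ η : Ed d, ‖ξ‖ = ‖η‖ → β0 ξ = β0 η) ∧
  (∀ ξ : Ed d, ‖ξ‖ ≤ 1 → β0 ξ = 1) ∧ (∀ ξ : Ed d, 2 ≤ ‖ξ‖ → β0 ξ = 0)

/-- `β_j(ξ) = β₀(2^{-j} ξ) - β₀(2^{1-j} ξ)`. -/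
def betaJ (d : ℕ) (β0 : Ed d → ℝ) (j : ℕ) (ξ : Ed d) : ℝ :=
  β0 ((2:ℝ) ^ (-(j:ℤ)) • ξ) - β0 ((2:ℝ) ^ (1 - (j:ℤ)) • ξ)

/-- The frequency-localized spherical mean `A_t^j f`, defined via the Fourier
multiplier `\widehat{dσ}(tξ) β_j(tξ)`. -/
def Aj (d : ℕ) (β0 : Ed d → ℝ) (j : ℕ) (t : ℝ) (f : Ed d → ℂ) (x : Ed d) : ℂ :=
  ∫ ξ : Ed d, eChar (2 * Real.pi * ⟪ξ, x⟫) *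
    (sigmaHat d (t • ξ) * (betaJ d β0 j (t • ξ) : ℂ) * fourierInt d f ξ)

/-- `B_t^j f = (∂/∂t) A_t^j f`. -/
def Bj (d : ℕ) (β0 : Ed d → ℝ) (j : ℕ) (t : ℝ) (f : Ed d → ℂ) (x : Ed d) : ℂ :=
  deriv (fun s : ℝ => Aj d β0 j s f x) t

theorem isFiniteMeasure_sphereProb {d : ℕ} (hd : 2 ≤ d) : IsFiniteMeasure (sphereProb d) := by
  have : Nonempty (Fin d) := ⟨⟨0, by omega⟩⟩
  have : Nontrivial (Ed d) := inferInstance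
  have h : (volume : Measure (Ed d)).toSphere ≠ 0 := Measure.toSphere_ne_zero _
  refine ⟨?_⟩
  rw [sphereProb, Measure.smul_apply, smul_eq_mul]
  exact ENNReal.mul_lt_top (ENNReal.inv_lt_top.2 (Measure.measure_univ_pos.2 h))
    (measure_lt_top _ _)

theorem le_volumeIoiPow_Icc (n : ℕ) {R : ℝ} (hR : 0 < R) :
    ENNReal.ofReal (R ^ n) ≤
      Measure.volumeIoiPow n {r : Ioi (0 : ℝ) | (r : ℝ) ∈ Icc R (R + 1)} := by
  have hm : MeasurableSet {r : Ioi (0 : ℝ) | (r : ℝ) ∈ Icc R (R + 1)} :=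
    measurable_subtype_coe measurableSet_Icc
  rw [Measure.volumeIoiPow, withDensity_apply _ hm]
  calc ENNReal.ofReal (R ^ n)
      = ∫⁻ _ in {r : Ioi (0 : ℝ) | (r : ℝ) ∈ Icc R (R + 1)}, ENNReal.ofReal (R ^ n)
          ∂(Measure.comap Subtype.val volume) := by
        rw [setLIntegral_const, comap_subtype_coe_apply measurableSet_Ioi]
        have : (Subtype.val '' {r : Ioi (0 : ℝ) | (r : ℝ) ∈ Icc R (R + 1)}) = Icc R (R + 1) := by
          ext r
          simp only [Set.mem_image, Set.mem_ofPred_eq, Subtype.exists, exists_and_right, exists_eq_right]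
          exact ⟨fun h => h.2, fun h => ⟨hR.trans_le h.1, h⟩⟩
        rw [this]
        simp
    _ ≤ _ := by
        refine setLIntegral_mono' hm fun r hr => ?_
        have : R ≤ r := hr.1
        gcongr

theorem lintegral_eq_lintegral_toSphere_prod {d : ℕ} (hd : 2 ≤ d) {g : Ed d → ℝ≥0∞}
    (hg : Measurable g) :
    ∫⁻ u, g u = ∫⁻ ω : sphere (0 : Ed d) 1, ∫⁻ r : Ioi (0 : ℝ), g ((r : ℝ) • (ω : Ed d))
      ∂(Measure.volumeIoiPow (d - 1)) ∂(volume : Measure (Ed d)).toSphere := by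
  have : Nonempty (Fin d) := ⟨⟨0, by omega⟩⟩
  have : Nontrivial (Ed d) := inferInstance
  have hmp := (volume : Measure (Ed d)).measurePreserving_homeomorphUnitSphereProd
  have hmeas : Measurable fun p : sphere (0 : Ed d) 1 × Ioi (0 : ℝ) =>
      g ((p.2 : ℝ) • (p.1 : Ed d)) := by fun_prop
  rw [finrank_euclideanSpace_fin] at hmp
  have h1 := hmp.lintegral_comp hmeas
  rw [← lintegral_prod _ hmeas.aemeasurable, ← h1]
  have h2 : ∀ u : ({(0 : Ed d)}ᶜ : Set (Ed d)),
      ((homeomorphUnitSphereProd (Ed d) u).2 : ℝ) •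
        ((homeomorphUnitSphereProd (Ed d) u).1 : Ed d) = u := by
    intro u
    have : ‖(u : Ed d)‖ ≠ 0 := norm_ne_zero_iff.2 u.2
    simp [smul_smul, this]
  simp_rw [h2]
  rw [lintegral_subtype_comap (measurableSet_singleton (0 : Ed d)).compl g,
    restrict_compl_singleton]

/-- Rescaled decay on a sphere of radius `R ≥ 1` gains the factor `R ^ (1 - d)`. -/
theorem exists_integral_sphere_decay_le {d : ℕ} (hd : 2 ≤ d) {r : ℝ} (hr : (d : ℝ) < r) :
    ∃ C : ℝ, 0 ≤ C ∧ ∀ R : ℝ, 1 ≤ R → ∀ v : Ed d,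
      ∫ ω : sphere (0 : Ed d) 1, (1 + ‖v - R • (ω : Ed d)‖) ^ (-r) ∂(sphereProb d) ≤
        C * (R ^ (d - 1))⁻¹ := by
  have := isFiniteMeasure_sphereProb hd
  have hr0 : 0 < r := (Nat.cast_nonneg d).trans_lt hr
  set μ := (volume : Measure (Ed d)).toSphere
  have hint : Integrable (fun u : Ed d => (1 + ‖u‖) ^ (-r)) :=
    integrable_one_add_norm (by simpa using hr)
  set I := ∫ u : Ed d, (1 + ‖u‖) ^ (-r)
  have hI : 0 ≤ I := integral_nonneg fun u => by positivity
  refine ⟨(μ univ)⁻¹.toReal * (2 ^ r * I), by positivity, fun R hR v => ?_⟩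
  have hR0 : 0 < R := by linarith
  set J := ∫ ω : sphere (0 : Ed d) 1, (1 + ‖v - R • (ω : Ed d)‖) ^ (-r) ∂μ
  have hJint : Integrable (fun ω : sphere (0 : Ed d) 1 => (1 + ‖v - R • (ω : Ed d)‖) ^ (-r)) μ := by
    refine Integrable.of_bound (C := 1) (by
      apply Measurable.aestronglyMeasurable; fun_prop) (.of_forall fun ω => ?_)
    rw [Real.norm_of_nonneg (by positivity)]
    exact Real.rpow_le_one_of_one_le_of_nonpos (by simp) (by linarith)
  have key : ENNReal.ofReal (2 ^ (-r) * R ^ (d - 1) * J) ≤ ENNReal.ofReal I := by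
    have e1 : ENNReal.ofReal I = ∫⁻ u : Ed d, ENNReal.ofReal ((1 + ‖v - u‖) ^ (-r)) := by
      rw [lintegral_sub_left_eq_self (fun u : Ed d => ENNReal.ofReal ((1 + ‖u‖) ^ (-r))) v,
        ofReal_integral_eq_lintegral_ofReal hint (.of_forall fun u => by positivity)]
    rw [e1, lintegral_eq_lintegral_toSphere_prod hd (by fun_prop), mul_comm,
      ENNReal.ofReal_mul (integral_nonneg fun _ => by positivity),
      ofReal_integral_eq_lintegral_ofReal hJint (.of_forall fun u => by positivity),
      ← lintegral_mul_const _ (by fun_prop)]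
    refine lintegral_mono fun ω => ?_
    have hω : ‖(ω : Ed d)‖ = 1 := by simp
    have hm : MeasurableSet {r : Ioi (0 : ℝ) | (r : ℝ) ∈ Icc R (R + 1)} :=
      measurable_subtype_coe measurableSet_Icc
    calc ENNReal.ofReal ((1 + ‖v - R • (ω : Ed d)‖) ^ (-r)) *
          ENNReal.ofReal (2 ^ (-r) * R ^ (d - 1))
        = ENNReal.ofReal ((2 * (1 + ‖v - R • (ω : Ed d)‖)) ^ (-r)) *
            ENNReal.ofReal (R ^ (d - 1)) := by
          rw [← ENNReal.ofReal_mul (by positivity), ← ENNReal.ofReal_mul (by positivity),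
            Real.mul_rpow (by positivity) (by positivity)]
          congr 1
          ring
      _ ≤ ENNReal.ofReal ((2 * (1 + ‖v - R • (ω : Ed d)‖)) ^ (-r)) *
            Measure.volumeIoiPow (d - 1) {r : Ioi (0 : ℝ) | (r : ℝ) ∈ Icc R (R + 1)} := by
          gcongr
          exact le_volumeIoiPow_Icc _ hR0
      _ = ∫⁻ _ in {r : Ioi (0 : ℝ) | (r : ℝ) ∈ Icc R (R + 1)},
            ENNReal.ofReal ((2 * (1 + ‖v - R • (ω : Ed d)‖)) ^ (-r))
              ∂(Measure.volumeIoiPow (d - 1)) := by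
          rw [setLIntegral_const]
      _ ≤ ∫⁻ s in {r : Ioi (0 : ℝ) | (r : ℝ) ∈ Icc R (R + 1)},
            ENNReal.ofReal ((1 + ‖v - (s : ℝ) • (ω : Ed d)‖) ^ (-r))
              ∂(Measure.volumeIoiPow (d - 1)) := by
          refine setLIntegral_mono' hm fun s hs => ENNReal.ofReal_le_ofReal ?_
          refine Real.rpow_le_rpow_of_nonpos (by positivity) ?_ (by linarith)
          have h1 : v - (s : ℝ) • (ω : Ed d) =
              (v - R • (ω : Ed d)) + (R - s) • (ω : Ed d) := by
            rw [sub_smul]; abel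
          have h2 : ‖(R - (s : ℝ)) • (ω : Ed d)‖ ≤ 1 := by
            rw [norm_smul, hω, mul_one, Real.norm_eq_abs, abs_le]
            constructor <;> linarith [hs.1, hs.2]
          have h3 := norm_add_le (v - R • (ω : Ed d)) ((R - (s : ℝ)) • (ω : Ed d))
          rw [h1]
          linarith [norm_nonneg (v - R • (ω : Ed d))]
      _ ≤ _ := setLIntegral_le_lintegral _ _
  rw [ENNReal.ofReal_le_ofReal_iff hI] at key
  have hJ : ∫ ω : sphere (0 : Ed d) 1, (1 + ‖v - R • (ω : Ed d)‖) ^ (-r) ∂(sphereProb d) =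
      (μ univ)⁻¹.toReal * J := by
    rw [sphereProb, integral_smul_measure, smul_eq_mul]
  rw [hJ, mul_assoc]
  refine mul_le_mul_of_nonneg_left ?_ (by positivity)
  rw [← div_eq_mul_inv, le_div_iff₀ (by positivity)]
  have h2 : (2 : ℝ) ^ r * 2 ^ (-r) = 1 := by
    rw [← Real.rpow_add (by norm_num)]; simp
  calc J * R ^ (d - 1) = 2 ^ r * (2 ^ (-r) * R ^ (d - 1) * J) := by
        linear_combination (-(R ^ (d - 1) * J)) * h2
    _ ≤ _ := by gcongr

/-- The rapidly decaying bump smeared over a sphere of radius `R` concentrates near it. -/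
theorem exists_integral_sphere_le_annulus {d : ℕ} (hd : 2 ≤ d) {M r : ℝ} (hM : 0 ≤ M)
    (hr : (d : ℝ) < r) :
    ∃ C : ℝ, 0 ≤ C ∧ ∀ R : ℝ, 1 ≤ R → ∀ v : Ed d,
      ∫ ω : sphere (0 : Ed d) 1, (1 + ‖v - R • (ω : Ed d)‖) ^ (-(M + r)) ∂(sphereProb d) ≤
        C * (R ^ (d - 1))⁻¹ * (1 + |‖v‖ - R|) ^ (-M) := by
  have := isFiniteMeasure_sphereProb hd
  obtain ⟨C, hC, h⟩ := exists_integral_sphere_decay_le hd hr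
  have hr0 : 0 < r := (Nat.cast_nonneg d).trans_lt hr
  refine ⟨C, hC, fun R hR v => ?_⟩
  have hbd : ∀ s : ℝ, 0 ≤ s → Integrable
      (fun ω : sphere (0 : Ed d) 1 => (1 + ‖v - R • (ω : Ed d)‖) ^ (-s)) (sphereProb d) := by
    intro s hs
    refine Integrable.of_bound (C := 1) (by
      apply Measurable.aestronglyMeasurable; fun_prop) (.of_forall fun ω => ?_)
    rw [Real.norm_of_nonneg (by positivity)]
    exact Real.rpow_le_one_of_one_le_of_nonpos (by simp) (by linarith)
  calc ∫ ω : sphere (0 : Ed d) 1, (1 + ‖v - R • (ω : Ed d)‖) ^ (-(M + r)) ∂(sphereProb d)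
      ≤ ∫ ω : sphere (0 : Ed d) 1, (1 + ‖v - R • (ω : Ed d)‖) ^ (-r) * (1 + |‖v‖ - R|) ^ (-M)
          ∂(sphereProb d) := by
        refine integral_mono (hbd _ (by linarith)) ((hbd r hr0.le).mul_const _) fun ω => ?_
        have hω : ‖R • (ω : Ed d)‖ = R := by
          rw [norm_smul, Real.norm_of_nonneg (by linarith)]; simp
        have h1 := abs_norm_sub_norm_le v (R • (ω : Ed d))
        rw [hω] at h1
        dsimp only
        rw [neg_add, add_comm (-M), Real.rpow_add (by positivity)]
        refine mul_le_mul_of_nonneg_left ?_ (by positivity)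
        exact Real.rpow_le_rpow_of_nonpos (by positivity) (by linarith) (by linarith)
    _ ≤ _ := by
        rw [integral_mul_const]
        exact mul_le_mul_of_nonneg_right (h R hR v) (by positivity)

theorem SchwartzMap.exists_norm_le_one_add_norm_rpow {E F : Type*} [NormedAddCommGroup E]
    [NormedSpace ℝ E] [NormedAddCommGroup F] [NormedSpace ℝ F] (Ψ : SchwartzMap E F) (r : ℝ) :
    ∃ C : ℝ, 0 ≤ C ∧ ∀ w, ‖Ψ w‖ ≤ C * (1 + ‖w‖) ^ (-r) ∧
      ‖fderiv ℝ Ψ w‖ ≤ C * (1 + ‖w‖) ^ (-r) := by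
  obtain ⟨n, hn⟩ := exists_nat_ge r
  set C := 2 ^ n * (Finset.Iic (n, 1)).sup (fun m => SchwartzMap.seminorm ℝ m.1 m.2) Ψ
  have key : ∀ (w : E) (z : ℝ), (1 + ‖w‖) ^ n * z ≤ C → z ≤ |C| * (1 + ‖w‖) ^ (-r) := by
    intro w z hz
    have h1 : (1 + ‖w‖) ^ r ≤ (1 + ‖w‖) ^ n := by
      rw [← Real.rpow_natCast]
      exact Real.rpow_le_rpow_of_exponent_le (by simp) hn
    rcases le_or_gt z 0 with h0 | h0
    · exact h0.trans (by positivity)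
    · rw [Real.rpow_neg (by positivity), ← div_eq_mul_inv, le_div_iff₀ (by positivity)]
      calc z * (1 + ‖w‖) ^ r ≤ z * (1 + ‖w‖) ^ n := by gcongr
        _ ≤ |C| := by rw [mul_comm]; exact hz.trans (le_abs_self _)
  refine ⟨|C|, abs_nonneg _, fun w => ⟨key w _ ?_, key w _ ?_⟩⟩
  · simpa using SchwartzMap.one_add_le_sup_seminorm_apply (𝕜 := ℝ) (m := (n, 1)) le_rfl
      (Nat.zero_le 1) Ψ w
  · simpa [norm_iteratedFDeriv_one] using SchwartzMap.one_add_le_sup_seminorm_apply (𝕜 := ℝ)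
      (m := (n, 1)) le_rfl le_rfl Ψ w

theorem continuous_eChar : Continuous eChar := by
  unfold eChar; fun_prop

theorem norm_eChar (r : ℝ) : ‖eChar r‖ = 1 := Complex.norm_exp_ofReal_mul_I r

theorem eChar_add (r s : ℝ) : eChar (r + s) = eChar r * eChar s := by
  simp [eChar, add_mul, Complex.exp_add]

/-- The annular bump `ξ ↦ β₀ ξ - β₀ (2 ξ)`, as a complex Schwartz function. -/
theorem IsAdmissibleBump.exists_schwartz {d : ℕ} {β0 : Ed d → ℝ} (h : IsAdmissibleBump d β0) :
    ∃ ψ : SchwartzMap (Ed d) ℂ, ∀ (j : ℕ) (ξ : Ed d),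
      (betaJ d β0 j ξ : ℂ) = ψ (((2 : ℝ) ^ j)⁻¹ • ξ) := by
  obtain ⟨hs, hc, -⟩ := h
  let g : Ed d → ℂ := fun ξ => ((β0 ξ - β0 ((2 : ℝ) • ξ) : ℝ) : ℂ)
  have hg : ContDiff ℝ (⊤ : ℕ∞) g :=
    Complex.ofRealCLM.contDiff.comp (hs.sub (hs.comp (contDiff_const_smul (2 : ℝ))))
  have hgc : HasCompactSupport g :=
    (hc.sub (hc.comp_smul (two_ne_zero (α := ℝ)))).comp_left (g := ((↑) : ℝ → ℂ)) (by simp)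
  refine ⟨hgc.toSchwartzMap hg, fun j ξ => ?_⟩
  change _ = g _
  simp only [g, betaJ, smul_smul]
  rw [zpow_sub₀ (by norm_num), zpow_neg]
  simp [div_eq_mul_inv]

/-- Fourier inversion for the dilated bump. -/
theorem integral_eChar_mul_schwartz {d : ℕ} (ψ : SchwartzMap (Ed d) ℂ) {a : ℝ} (ha : 0 < a)
    (z : Ed d) :
    ∫ ξ : Ed d, eChar (2 * Real.pi * ⟪ξ, z⟫) * ψ (a⁻¹ • ξ) =
      (a : ℂ) ^ d * (FourierTransform.fourierInv ψ : SchwartzMap (Ed d) ℂ) (a • z) := by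
  have h1 : ∀ ξ : Ed d, eChar (2 * Real.pi * ⟪ξ, z⟫) * ψ (a⁻¹ • ξ) =
      (fun η : Ed d => eChar (2 * Real.pi * ⟪η, a • z⟫) * ψ η) (a⁻¹ • ξ) := by
    intro ξ
    simp only [inner_smul_left, inner_smul_right]
    congr 3
    simp
    field_simp
  rw [integral_congr_ae (.of_forall h1), Measure.integral_comp_smul volume
    (fun η : Ed d => eChar (2 * Real.pi * ⟪η, a • z⟫) * ψ η), SchwartzMap.fourierInv_coe, Real.fourierInv_eq',
    finrank_euclideanSpace_fin]
  have : |((a⁻¹) ^ d)⁻¹| = a ^ d := by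
    rw [inv_pow, inv_inv, abs_of_pos (by positivity)]
  rw [this, Complex.real_smul]
  simp [eChar]

/-- The integrand of the physical-space formula for `Aj`, at scale `a = R / t`. -/
def physIntegrand {d : ℕ} (Ψ f : Ed d → ℂ) (R : ℝ) (x : Ed d) (a : ℝ)
    (p : Ed d × sphere (0 : Ed d) 1) : ℂ :=
  (a : ℂ) ^ d * Ψ (a • (x - p.1) - R • (p.2 : Ed d)) * f p.1

theorem Aj_eq_integral {d : ℕ} (hd : 2 ≤ d) {β0 : Ed d → ℝ} {ψ : SchwartzMap (Ed d) ℂ}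
    (hψ : ∀ (j : ℕ) (ξ : Ed d), (betaJ d β0 j ξ : ℂ) = ψ (((2 : ℝ) ^ j)⁻¹ • ξ))
    (j : ℕ) {t : ℝ} (ht : 0 < t) (f : SchwartzMap (Ed d) ℂ) (x : Ed d) :
    Aj d β0 j t f x =
      ∫ p, physIntegrand (FourierTransform.fourierInv ψ : SchwartzMap (Ed d) ℂ) f
        ((2 : ℝ) ^ j) x ((2 : ℝ) ^ j / t) p
        ∂((volume : Measure (Ed d)).prod (sphereProb d)) := by
  have := isFiniteMeasure_sphereProb hd
  set R : ℝ := (2 : ℝ) ^ j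
  have hR : 0 < R := by positivity
  set a : ℝ := R / t with ha
  have ha0 : 0 < a := by positivity
  have hat : a * t = R := by rw [ha]; field_simp
  let G : Ed d → Ed d × sphere (0 : Ed d) 1 → ℂ := fun ξ p =>
    eChar (2 * Real.pi * ⟪ξ, x - p.1 - t • (p.2 : Ed d)⟫) * ψ (a⁻¹ • ξ) * f p.1
  have hcont : Continuous (Function.uncurry G) := by
    have := continuous_eChar
    have := ψ.continuous
    have := f.continuous
    simp only [G, Function.uncurry_def]
    fun_prop
  have hψi : Integrable fun ξ : Ed d => ψ (a⁻¹ • ξ) :=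
    (integrable_comp_smul_iff volume _ (inv_ne_zero ha0.ne')).2 ψ.integrable
  have hGint : Integrable (Function.uncurry G)
      ((volume : Measure (Ed d)).prod ((volume : Measure (Ed d)).prod (sphereProb d))) := by
    refine (hψi.mul_prod (f.integrable.comp_fst (sphereProb d))).mono
      hcont.aestronglyMeasurable (.of_forall fun q => ?_)
    simp [G, Function.uncurry_def, norm_eChar]
  calc Aj d β0 j t f x
      = ∫ ξ : Ed d, ∫ p, G ξ p ∂((volume : Measure (Ed d)).prod (sphereProb d)) := by
        refine integral_congr_ae (.of_forall fun ξ => ?_)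
        dsimp only
        have h1 : ∀ p : Ed d × sphere (0 : Ed d) 1, G ξ p =
            (eChar (2 * Real.pi * ⟪ξ, x⟫) * ψ (a⁻¹ • ξ)) *
              ((eChar (-(2 * Real.pi * ⟪ξ, p.1⟫)) * f p.1) *
                eChar (-(2 * Real.pi * ⟪t • ξ, (p.2 : Ed d)⟫))) := by
          intro p
          have : 2 * Real.pi * ⟪ξ, x - p.1 - t • (p.2 : Ed d)⟫ =
              2 * Real.pi * ⟪ξ, x⟫ + (-(2 * Real.pi * ⟪ξ, p.1⟫) +
                -(2 * Real.pi * ⟪t • ξ, (p.2 : Ed d)⟫)) := by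
            simp only [inner_sub_right, inner_smul_right, inner_smul_left]
            simp
            ring
          simp only [G, this, eChar_add]
          ring
        simp_rw [h1]
        rw [integral_const_mul, integral_prod_mul
          (fun y : Ed d => eChar (-(2 * Real.pi * ⟪ξ, y⟫)) * f y)
          (fun ω : sphere (0 : Ed d) 1 => eChar (-(2 * Real.pi * ⟪t • ξ, (ω : Ed d)⟫))), hψ]
        have : R⁻¹ • t • ξ = a⁻¹ • ξ := by
          rw [smul_smul, ha]; congr 1; field_simp
        rw [this]
        simp only [sigmaHat, fourierInt]
        ring
    _ = ∫ p, (∫ ξ : Ed d, G ξ p) ∂((volume : Measure (Ed d)).prod (sphereProb d)) :=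
        integral_integral_swap hGint
    _ = _ := by
        refine integral_congr_ae (.of_forall fun p => ?_)
        simp only [G, physIntegrand]
        rw [integral_mul_const, integral_eChar_mul_schwartz ψ ha0, smul_sub, smul_smul, hat]

/-- The derivative of `physIntegrand` in the scale `a`. -/
def physIntegrandDeriv {d : ℕ} (Ψ f : Ed d → ℂ) (R : ℝ) (x : Ed d) (a : ℝ)
    (p : Ed d × sphere (0 : Ed d) 1) : ℂ :=
  ((d : ℂ) * (a : ℂ) ^ (d - 1) * Ψ (a • (x - p.1) - R • (p.2 : Ed d)) +
    (a : ℂ) ^ d * fderiv ℝ Ψ (a • (x - p.1) - R • (p.2 : Ed d)) (x - p.1)) * f p.1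

theorem hasDerivAt_physIntegrand {d : ℕ} (Ψ : SchwartzMap (Ed d) ℂ) (f : Ed d → ℂ) (R : ℝ)
    (x : Ed d) (a : ℝ) (p : Ed d × sphere (0 : Ed d) 1) :
    HasDerivAt (fun a => physIntegrand Ψ f R x a p) (physIntegrandDeriv Ψ f R x a p) a := by
  have h1 : HasDerivAt (fun a : ℝ => (a : ℂ) ^ d) ((d : ℂ) * (a : ℂ) ^ (d - 1)) a := by
    simpa using (hasDerivAt_pow d (a : ℂ)).comp_ofReal
  have h2 : HasDerivAt (fun a : ℝ => a • (x - p.1) - R • (p.2 : Ed d)) (x - p.1) a := by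
    simpa using ((hasDerivAt_id a).smul_const (x - p.1)).sub_const (R • (p.2 : Ed d))
  exact (h1.mul ((Ψ.differentiableAt.hasFDerivAt).comp_hasDerivAt a h2)).mul_const _

theorem norm_physIntegrand_le {d : ℕ} {Ψ : Ed d → ℂ} {C N : ℝ}
    (hΨ : ∀ w, ‖Ψ w‖ ≤ C * (1 + ‖w‖) ^ (-N)) (f : Ed d → ℂ) (R : ℝ) (x : Ed d) {a : ℝ}
    (ha : 0 < a) (p : Ed d × sphere (0 : Ed d) 1) :
    ‖physIntegrand Ψ f R x a p‖ ≤
      C * a ^ d * ((1 + ‖a • (x - p.1) - R • (p.2 : Ed d)‖) ^ (-N) * ‖f p.1‖) := by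
  rw [physIntegrand, norm_mul, norm_mul, norm_pow, Complex.norm_real, Real.norm_of_nonneg ha.le]
  calc _ ≤ a ^ d * (C * (1 + ‖a • (x - p.1) - R • (p.2 : Ed d)‖) ^ (-N)) * ‖f p.1‖ := by
        gcongr
        exact hΨ _
    _ = _ := by ring

theorem norm_physIntegrandDeriv_le {d : ℕ} {Ψ : Ed d → ℂ} {C N : ℝ} (hC : 0 ≤ C)
    (hΨ : ∀ w, ‖Ψ w‖ ≤ C * (1 + ‖w‖) ^ (-(N + 1)) ∧
      ‖fderiv ℝ Ψ w‖ ≤ C * (1 + ‖w‖) ^ (-(N + 1))) (f : Ed d → ℂ) {R : ℝ} (hR : 1 ≤ R) (x : Ed d)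
    {a : ℝ} (ha : 0 < a) (p : Ed d × sphere (0 : Ed d) 1) :
    ‖physIntegrandDeriv Ψ f R x a p‖ ≤ (d + 1) * C * a ^ d * (R / a) *
      ((1 + ‖a • (x - p.1) - R • (p.2 : Ed d)‖) ^ (-N) * ‖f p.1‖) := by
  set w := a • (x - p.1) - R • (p.2 : Ed d) with hw
  have hR0 : 0 < R := by linarith
  set S := (1 + ‖w‖) ^ (-(N + 1)) with hS
  have hS0 : 0 ≤ S := by positivity
  have hSN : (1 + ‖w‖) ^ (-N) = (1 + ‖w‖) * S := by
    rw [hS, show -N = 1 + -(N + 1) by ring, Real.rpow_add (by positivity), Real.rpow_one]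
  have hz : a * ‖x - p.1‖ ≤ R * (1 + ‖w‖) := by
    have h1 : a • (x - p.1) = w + R • (p.2 : Ed d) := by rw [hw]; abel
    have h2 : ‖R • (p.2 : Ed d)‖ = R := by
      rw [norm_smul, Real.norm_of_nonneg hR0.le]; simp
    have h3 := norm_add_le w (R • (p.2 : Ed d))
    rw [← h1, norm_smul, Real.norm_of_nonneg ha.le, h2] at h3
    nlinarith [norm_nonneg w]
  have hz' : ‖x - p.1‖ ≤ R / a * (1 + ‖w‖) := by
    rw [div_mul_eq_mul_div, le_div_iff₀ ha]; linarith
  have hpow : (d : ℝ) * a ^ (d - 1) = d * a ^ d / a := by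
    rcases d with _ | n
    · simp
    · simp only [Nat.add_sub_cancel]; rw [pow_succ]; field_simp
  have hA : ‖(d : ℂ) * (a : ℂ) ^ (d - 1) * Ψ w‖ ≤ d * C * a ^ d * (R / a) * ((1 + ‖w‖) * S) := by
    rw [norm_mul, norm_mul, norm_pow, Complex.norm_real, Real.norm_of_nonneg ha.le,
      Complex.norm_natCast, hpow]
    calc d * a ^ d / a * ‖Ψ w‖ ≤ d * a ^ d / a * (C * S) := by
          gcongr
          exact (hΨ w).1
      _ ≤ d * a ^ d / a * (C * S) * (R * (1 + ‖w‖)) := by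
          refine le_mul_of_one_le_right (by positivity) ?_
          nlinarith [norm_nonneg w]
      _ = _ := by ring
  have hB : ‖(a : ℂ) ^ d * fderiv ℝ Ψ w (x - p.1)‖ ≤ C * a ^ d * (R / a) * ((1 + ‖w‖) * S) := by
    rw [norm_mul, norm_pow, Complex.norm_real, Real.norm_of_nonneg ha.le]
    calc a ^ d * ‖fderiv ℝ Ψ w (x - p.1)‖ ≤ a ^ d * (‖fderiv ℝ Ψ w‖ * ‖x - p.1‖) := by
          gcongr
          exact ContinuousLinearMap.le_opNorm _ _
      _ ≤ a ^ d * ((C * S) * (R / a * (1 + ‖w‖))) := by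
          gcongr
          exact (hΨ w).2
      _ = _ := by ring
  rw [physIntegrandDeriv, norm_mul, hSN]
  calc _ ≤ (d * C * a ^ d * (R / a) * ((1 + ‖w‖) * S) + C * a ^ d * (R / a) * ((1 + ‖w‖) * S)) *
          ‖f p.1‖ := by
        gcongr
        exact (norm_add_le _ _).trans (add_le_add hA hB)
    _ = _ := by ring

theorem continuous_physIntegrand {d : ℕ} (Ψ f : SchwartzMap (Ed d) ℂ) (R : ℝ) (x : Ed d) (a : ℝ) :
    Continuous (physIntegrand Ψ f R x a) := by
  have := Ψ.continuous
  have := f.continuous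
  unfold physIntegrand
  fun_prop

theorem continuous_physIntegrandDeriv {d : ℕ} (Ψ f : SchwartzMap (Ed d) ℂ) (R : ℝ) (x : Ed d)
    (a : ℝ) : Continuous (physIntegrandDeriv Ψ f R x a) := by
  have := Ψ.continuous
  have := f.continuous
  have : Continuous (fderiv ℝ Ψ) := (Ψ.smooth 1).continuous_fderiv one_ne_zero
  unfold physIntegrandDeriv
  fun_prop

theorem integrable_decay_mul {d : ℕ} (hd : 2 ≤ d) {N : ℝ} (hN : 0 ≤ N)
    (f : SchwartzMap (Ed d) ℂ) (R : ℝ) (x : Ed d) (a : ℝ) :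
    Integrable (fun p : Ed d × sphere (0 : Ed d) 1 =>
      (1 + ‖a • (x - p.1) - R • (p.2 : Ed d)‖) ^ (-N) * ‖f p.1‖)
      ((volume : Measure (Ed d)).prod (sphereProb d)) := by
  have := isFiniteMeasure_sphereProb hd
  have := f.continuous
  refine (f.integrable.comp_fst (sphereProb d)).mono
    (Measurable.aestronglyMeasurable (by fun_prop)) (.of_forall fun p => ?_)
  rw [Real.norm_of_nonneg (by positivity)]
  exact mul_le_of_le_one_left (norm_nonneg _)
    (Real.rpow_le_one_of_one_le_of_nonpos (by simp) (by linarith))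

theorem hasDerivAt_integral_physIntegrand {d : ℕ} (hd : 2 ≤ d) (Ψ f : SchwartzMap (Ed d) ℂ)
    {R : ℝ} (hR : 1 ≤ R) (x : Ed d) {a : ℝ} (ha : 0 < a) :
    HasDerivAt (fun a => ∫ p, physIntegrand Ψ f R x a p
        ∂((volume : Measure (Ed d)).prod (sphereProb d)))
      (∫ p, physIntegrandDeriv Ψ f R x a p ∂((volume : Measure (Ed d)).prod (sphereProb d))) a := by
  have := isFiniteMeasure_sphereProb hd
  obtain ⟨C, hC, hΨ⟩ := Ψ.exists_norm_le_one_add_norm_rpow ((0 : ℝ) + 1)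
  have hfi := (f.integrable (μ := volume)).norm.comp_fst (sphereProb d)
  have hR0 : 0 < R := by linarith
  refine (hasDerivAt_integral_of_dominated_loc_of_deriv_le
    (bound := fun p => (d + 1) * C * (2 * a) ^ d * (R / (a / 2)) * ‖f p.1‖)
    (Ioo_mem_nhds (half_lt_self ha) (by linarith : a < 2 * a))
    (.of_forall fun b => (continuous_physIntegrand Ψ f R x b).aestronglyMeasurable) ?_
    (continuous_physIntegrandDeriv Ψ f R x a).aestronglyMeasurable
    (.of_forall fun p b hb => ?_) (hfi.const_mul _)
    (.of_forall fun p b _ => hasDerivAt_physIntegrand Ψ f R x b p)).2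
  · exact ((integrable_decay_mul hd (by norm_num) f R x a).const_mul (C * a ^ d)).mono'
      (continuous_physIntegrand Ψ f R x a).aestronglyMeasurable
      (.of_forall fun p => norm_physIntegrand_le (fun w => (hΨ w).1) f R x ha p)
  · have hb0 : 0 < b := (half_pos ha).trans hb.1
    refine (norm_physIntegrandDeriv_le hC hΨ f hR x hb0 p).trans ?_
    simp only [neg_zero, Real.rpow_zero, one_mul]
    gcongr
    · exact hb.2.le
    · exact hb.1.le

theorem integral_annulus_le {d : ℕ} (hd : 2 ≤ d) {M r : ℝ} (hM : 0 ≤ M) (hr : (d : ℝ) < r) :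
    ∃ C : ℝ, 0 ≤ C ∧ ∀ R : ℝ, 1 ≤ R → ∀ t : ℝ, 0 < t → ∀ f : SchwartzMap (Ed d) ℂ, ∀ x : Ed d,
      (R / t) ^ d * ∫ p : Ed d × sphere (0 : Ed d) 1,
        (1 + ‖(R / t) • (x - p.1) - R • (p.2 : Ed d)‖) ^ (-(M + r)) * ‖f p.1‖
          ∂((volume : Measure (Ed d)).prod (sphereProb d)) ≤
      C * (R * ∫ y : Ed d, t ^ (-(d : ℝ)) * (1 + R * |‖x - y‖ / t - 1|) ^ (-M) * ‖f y‖) := by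
  have := isFiniteMeasure_sphereProb hd
  obtain ⟨C, hC, h⟩ := exists_integral_sphere_le_annulus hd hM hr
  have hr0 : 0 < r := (Nat.cast_nonneg d).trans_lt hr
  refine ⟨C, hC, fun R hR t ht f x => ?_⟩
  have hR0 : 0 < R := by linarith
  have hint := integrable_decay_mul hd (N := M + r) (by linarith) f R x (R / t)
  have hpow : R ^ d = R ^ (d - 1) * R := by
    rw [← pow_succ]; congr 1; omega
  rw [integral_prod _ hint, ← integral_const_mul, ← integral_const_mul, ← integral_const_mul]
  refine integral_mono_of_nonneg (.of_forall fun y => ?_) ?_ (.of_forall fun y => ?_)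
  · exact mul_nonneg (by positivity) (integral_nonneg fun ω => by positivity)
  · have := f.continuous
    refine ((f.integrable.const_mul ((C * (R * t ^ (-(d : ℝ))) : ℝ) : ℂ))).mono
      (Measurable.aestronglyMeasurable (by fun_prop)) (.of_forall fun y => ?_)
    rw [Real.norm_of_nonneg (by positivity), norm_mul, Complex.norm_real,
      Real.norm_of_nonneg (by positivity)]
    have : (1 + R * |‖x - y‖ / t - 1|) ^ (-M) ≤ 1 :=
      Real.rpow_le_one_of_one_le_of_nonpos (le_add_of_nonneg_right (by positivity)) (by linarith)
    calc _ ≤ C * (R * (t ^ (-(d : ℝ)) * 1 * ‖f y‖)) := by gcongr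
      _ = _ := by ring
  · dsimp only
    rw [integral_mul_const]
    have h1 : |‖(R / t) • (x - y)‖ - R| = R * |‖x - y‖ / t - 1| := by
      rw [norm_smul, Real.norm_of_nonneg (by positivity), ← abs_of_pos hR0, ← abs_mul,
        abs_of_pos hR0]
      congr 1; ring
    have h2 := h R hR ((R / t) • (x - y))
    rw [h1] at h2
    calc _ ≤ (R / t) ^ d * (C * (R ^ (d - 1))⁻¹ * (1 + R * |‖x - y‖ / t - 1|) ^ (-M) * ‖f y‖) := by
          gcongr
      _ = _ := by
          rw [div_pow, hpow, Real.rpow_neg ht.le, Real.rpow_natCast]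
          field_simp

/-- Lemma 2.1 (i): pointwise kernel bound for `A_t^j` and `B_t^j`. -/
theorem Aj_kernel_bound (d : ℕ) (hd : 2 ≤ d) (β0 : Ed d → ℝ)
    (hβ0 : IsAdmissibleBump d β0) (M : ℝ) (hM : (d:ℝ) < M) :
    ∃ C : ℝ, 0 < C ∧ ∀ (k : ℤ) (j : ℕ), 10 ≤ j →
      ∀ t : ℝ, t ∈ Set.Icc ((2:ℝ) ^ k) ((2:ℝ) ^ (k + 1)) →
      ∀ f : SchwartzMap (Ed d) ℂ, ∀ x : Ed d,
        ‖Aj d β0 j t (⇑f) x‖ + (2:ℝ) ^ (-(j:ℝ)) * t * ‖Bj d β0 j t (⇑f) x‖ ≤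
          C * (2:ℝ) ^ (j:ℝ) *
            ∫ y : Ed d,
              t ^ (-(d:ℝ)) * (1 + (2:ℝ) ^ (j:ℝ) * |‖x - y‖ / t - 1|) ^ (-M) * ‖f y‖ := by
  have hM0 : 0 ≤ M := (Nat.cast_nonneg d).trans hM.le
  obtain ⟨ψ, hψ⟩ := hβ0.exists_schwartz
  set Ψ : SchwartzMap (Ed d) ℂ := FourierTransform.fourierInv ψ
  obtain ⟨C₁, hC₁, hΨ⟩ := Ψ.exists_norm_le_one_add_norm_rpow ((M + (d + 1)) + 1)
  obtain ⟨C₂, hC₂, hann⟩ := integral_annulus_le hd hM0 (lt_add_one (d : ℝ))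
  refine ⟨(d + 2) * C₁ * C₂ + 1, by positivity, fun k j _ t ht f x => ?_⟩
  have ht0 : 0 < t := lt_of_lt_of_le (by positivity) ht.1
  rw [Real.rpow_neg (by norm_num), Real.rpow_natCast]
  set R : ℝ := (2 : ℝ) ^ j
  have hR : 1 ≤ R := one_le_pow₀ (by norm_num)
  have hR0 : 0 < R := by linarith
  have ha : 0 < R / t := by positivity
  set ν := (volume : Measure (Ed d)).prod (sphereProb d)
  set I := ∫ y : Ed d, t ^ (-(d : ℝ)) * (1 + R * |‖x - y‖ / t - 1|) ^ (-M) * ‖f y‖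
  have hI : 0 ≤ I := integral_nonneg fun y => by positivity
  set D := ∫ p : Ed d × sphere (0 : Ed d) 1,
    (1 + ‖(R / t) • (x - p.1) - R • (p.2 : Ed d)‖) ^ (-(M + (d + 1))) * ‖f p.1‖ ∂ν
  have hD : (R / t) ^ d * D ≤ C₂ * (R * I) := hann R hR t ht0 f x
  have hint := integrable_decay_mul hd (N := M + (d + 1)) (by positivity) f R x (R / t)
  have hA : ‖Aj d β0 j t f x‖ ≤ C₁ * ((R / t) ^ d * D) := by
    rw [Aj_eq_integral hd hψ j ht0 f x, ← mul_assoc, ← integral_const_mul]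
    refine norm_integral_le_of_norm_le (hint.const_mul _) (.of_forall fun p => ?_)
    refine norm_physIntegrand_le (fun w => (hΨ w).1.trans ?_) f R x ha p
    exact mul_le_mul_of_nonneg_left
      (Real.rpow_le_rpow_of_exponent_le (by simp) (by linarith)) hC₁
  have hB : Bj d β0 j t f x =
      (-(R / t ^ 2) : ℝ) • ∫ p, physIntegrandDeriv Ψ f R x (R / t) p ∂ν := by
    have h1 : HasDerivAt (fun s : ℝ => R / s) (-(R / t ^ 2)) t := by
      simpa [div_eq_mul_inv] using (hasDerivAt_inv ht0.ne').const_mul R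
    have h2 := (hasDerivAt_integral_physIntegrand hd Ψ f hR x ha).scomp t h1
    refine (h2.congr_of_eventuallyEq ?_).deriv
    filter_upwards [lt_mem_nhds ht0] with s hs
    exact Aj_eq_integral hd hψ j hs f x
  have hB' : ‖∫ p, physIntegrandDeriv Ψ f R x (R / t) p ∂ν‖ ≤
      (d + 1) * C₁ * (R / t) ^ d * (R / (R / t)) * D := by
    rw [← integral_const_mul]
    exact norm_integral_le_of_norm_le (hint.const_mul _) (.of_forall fun p =>
      norm_physIntegrandDeriv_le hC₁ hΨ f hR x ha p)
  have hB'' : R⁻¹ * t * ‖Bj d β0 j t f x‖ ≤ (d + 1) * C₁ * ((R / t) ^ d * D) := by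
    rw [hB, norm_smul, norm_neg, Real.norm_of_nonneg (by positivity)]
    calc _ ≤ R⁻¹ * t * (R / t ^ 2 * ((d + 1) * C₁ * (R / t) ^ d * (R / (R / t)) * D)) := by
          gcongr
      _ = _ := by
          rw [div_div_cancel₀ hR0.ne']
          field_simp
  calc _ ≤ C₁ * ((R / t) ^ d * D) + (d + 1) * C₁ * ((R / t) ^ d * D) := add_le_add hA hB''
    _ = (d + 2) * C₁ * ((R / t) ^ d * D) := by ring
    _ ≤ (d + 2) * C₁ * (C₂ * (R * I)) := by gcongr
    _ ≤ ((d + 2) * C₁ * C₂ + 1) * R * I := by nlinarith [mul_nonneg hR0.le hI]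
end
end
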